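/- arXiv:1906.08347 — 2 statements merged into one kernel-verified Lean document; each statement's English description precedes it below -/
import Mathlib

section
/- For all integers n ≥ 0, m ≥ 0 and i ≥ −1 (with m ≥ 1 when i = −1), the normalized logarithmic integral S_{n,m}^{(i)} belongs to the ℚ-subalgebra of ℝ generated by the Riemann zeta values ζ(2), ζ(3), ζ(4), …; that is, S_{n,m}^{(i)} is a polynomial with rational coefficients in the numbers ∑_{ℓ=1}^{∞} 1/ℓ^k for k ≥ 2. -/
open MeasureTheory Set Filter Topology

lemma mgf_aux (w X : ℝ → ℝ) (hw : Measurable w) (hw0 : ∀ x ∈ Ioo (0:ℝ) 1, 0 ≤ w x) (t0 : ℝ)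
    (hint : ∀ t > t0, IntegrableOn (fun x => w x * Real.exp (t * X x)) (Ioo 0 1)) (t : ℝ) (ht : t0 < t) :
    AnalyticAt ℝ (fun t => ∫ x in Ioo (0:ℝ) 1, w x * Real.exp (t * X x)) t ∧
    ∀ n : ℕ, iteratedDeriv n (fun t => ∫ x in Ioo (0:ℝ) 1, w x * Real.exp (t * X x)) t =
       ∫ x in Ioo (0:ℝ) 1, w x * (X x ^ n * Real.exp (t * X x)) ∧
       IntegrableOn (fun x => w x * (X x ^ n * Real.exp (t * X x))) (Ioo 0 1) := by
  set μ : Measure ℝ := (volume.restrict (Ioo (0:ℝ) 1)).withDensity (fun x => ENNReal.ofReal (w x)) with hμ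
  have hI : ∀ g : ℝ → ℝ, ∫ x, g x ∂μ = ∫ x in Ioo (0:ℝ) 1, w x * g x := by
    intro g
    rw [hμ, integral_withDensity_eq_integral_toReal_smul (by fun_prop) (by simp)]
    refine setIntegral_congr_fun measurableSet_Ioo fun x hx => ?_
    simp [ENNReal.toReal_ofReal (hw0 x hx)]
  have hJ : ∀ g : ℝ → ℝ, Integrable g μ ↔ IntegrableOn (fun x => w x * g x) (Ioo 0 1) := by
    intro g
    rw [hμ, integrable_withDensity_iff_integrable_smul' (by fun_prop) (by simp)]
    refine integrableOn_congr_fun (fun x hx => ?_) measurableSet_Ioo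
    simp [ENNReal.toReal_ofReal (hw0 x hx)]
  have hm : (fun t => ∫ x in Ioo (0:ℝ) 1, w x * Real.exp (t * X x)) = ProbabilityTheory.mgf X μ := by
    ext t
    rw [ProbabilityTheory.mgf, hI]
  have hmem : t ∈ interior (ProbabilityTheory.integrableExpSet X μ) := by
    rw [mem_interior]
    refine ⟨Ioi t0, fun s hs => ?_, isOpen_Ioi, ht⟩
    exact (hJ _).2 (hint s hs)
  rw [hm]
  refine ⟨ProbabilityTheory.analyticAt_mgf hmem, fun n => ⟨?_, ?_⟩⟩
  · rw [ProbabilityTheory.iteratedDeriv_mgf hmem, hI]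
  · rw [← hJ]
    exact ProbabilityTheory.integrable_pow_mul_exp_of_mem_interior_integrableExpSet hmem n

lemma beta_aux (a b : ℝ) (ha : 0 < a) (hb : 0 < b) :
    IntegrableOn (fun x => Real.exp (a * Real.log x) / (x * (1 - x)) * Real.exp (b * Real.log (1 - x))) (Ioo 0 1) ∧
    ∫ x in Ioo (0:ℝ) 1, Real.exp (a * Real.log x) / (x * (1 - x)) * Real.exp (b * Real.log (1 - x))
      = Real.Gamma a * Real.Gamma b / Real.Gamma (a + b) := by
  have h1 := Complex.betaIntegral_convergent (u := a) (v := b) (by simpa) (by simpa)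
  rw [intervalIntegrable_iff_integrableOn_Ioo_of_le zero_le_one] at h1
  have hE : EqOn (fun x : ℝ => ((x:ℂ) ^ ((a:ℂ) - 1) * (1 - (x:ℂ)) ^ ((b:ℂ) - 1)))
    (fun x => ((Real.exp (a * Real.log x) / (x * (1 - x)) * Real.exp (b * Real.log (1 - x)) : ℝ) : ℂ)) (Ioo 0 1) := by
    intro x hx
    have hx0 : 0 < x := hx.1
    have hx1 : 0 < 1 - x := by linarith [hx.2]
    have e1 : (x:ℂ) ^ ((a:ℂ) - 1) = ((x ^ (a-1) : ℝ) : ℂ) := by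
      rw [Complex.ofReal_cpow hx0.le]; push_cast; rfl
    have e2 : (1 - (x:ℂ)) ^ ((b:ℂ) - 1) = (((1-x) ^ (b-1) : ℝ) : ℂ) := by
      rw [Complex.ofReal_cpow hx1.le]; push_cast; rfl
    simp only [e1, e2]
    rw [← Complex.ofReal_mul, Real.rpow_sub_one hx0.ne', Real.rpow_sub_one hx1.ne', Real.rpow_def_of_pos hx0,
      Real.rpow_def_of_pos hx1, mul_comm a, mul_comm b]
    congr 1
    field_simp
  constructor
  · have := (integrableOn_congr_fun hE measurableSet_Ioo).1 h1
    exact this.re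
  · have h3 := ProbabilityTheory.beta_eq_betaIntegralReal a b ha hb
    rw [ProbabilityTheory.beta] at h3
    rw [h3, Complex.betaIntegral, intervalIntegral.integral_of_le zero_le_one, integral_Ioc_eq_integral_Ioo,
      setIntegral_congr_fun measurableSet_Ioo hE, integral_complex_ofReal, Complex.ofReal_re]

noncomputable def HH (m : ℕ) (a : ℝ) : ℝ :=
  ∫ x in Ioo (0:ℝ) 1, ((-Real.log (1 - x)) ^ m / x) * Real.exp (a * Real.log x)

noncomputable def BB (a b : ℝ) : ℝ :=
  ∫ x in Ioo (0:ℝ) 1, (Real.exp (a * Real.log x) / (x * (1 - x))) * Real.exp (b * Real.log (1 - x))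

lemma log_bd (m : ℕ) (x : ℝ) (hx : x ∈ Ioo (0:ℝ) 1) :
    0 ≤ -Real.log (1 - x) ∧
    (-Real.log (1 - x)) ^ m ≤ (2 * m + 2) ^ m * (x ^ m * Real.exp (-(1/2) * Real.log (1 - x))) := by
  have hx0 : 0 < x := hx.1
  have hx1 : 0 < 1 - x := by linarith [hx.2]
  have h0 : Real.log (1 - x) ≤ 0 := Real.log_nonpos hx1.le (by linarith)
  refine ⟨by linarith, ?_⟩
  set l := -Real.log (1 - x) with hl
  have hl0 : 0 ≤ l := by linarith
  set c : ℝ := 2 * m + 2 with hc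
  have hcp : 2 ≤ c := by have : (0:ℝ) ≤ m := by positivity
                         linarith
  have key : l ≤ c * (x * Real.exp (l / c)) := by
    have a1 : 1 - Real.exp (-(l / c)) ≤ x := by
      have : Real.exp (-l) ≤ Real.exp (-(l/c)) := by
        apply Real.exp_le_exp.2
        have : l / c ≤ l := div_le_self hl0 (by linarith)
        linarith
      have e : Real.exp (-l) = 1 - x := by rw [hl, neg_neg, Real.exp_log hx1]
      linarith
    have a2 : l / c + 1 ≤ Real.exp (l / c) := Real.add_one_le_exp _
    have a3 : Real.exp (l / c) * (1 - Real.exp (-(l/c))) = Real.exp (l/c) - 1 := by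
      rw [mul_sub, ← Real.exp_add]; simp
    have a4 : l / c ≤ x * Real.exp (l / c) := by
      have := mul_le_mul_of_nonneg_left a1 (Real.exp_pos (l/c)).le
      linarith
    rw [div_le_iff₀ (by linarith)] at a4
    linarith
  calc l ^ m ≤ (c * (x * Real.exp (l / c))) ^ m := pow_le_pow_left₀ hl0 key m
    _ = c ^ m * (x ^ m * Real.exp (m * (l / c))) := by rw [mul_pow, mul_pow, ← Real.exp_nat_mul]
    _ ≤ _ := by
      have h5 : m * (l / c) ≤ -(1/2) * Real.log (1 - x) := by
        have : m * (l / c) ≤ 1/2 * l := by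
          rw [← mul_div_assoc, div_le_iff₀ (by linarith)]
          rw [hc]; nlinarith
        linarith
      have h6 := Real.exp_le_exp.2 h5
      have h7 : 0 ≤ c := by linarith
      exact mul_le_mul_of_nonneg_left (mul_le_mul_of_nonneg_left h6 (by positivity)) (by positivity)

lemma HH_int (m : ℕ) (t : ℝ) (ht : -(m:ℝ) < t) :
    IntegrableOn (fun x => ((-Real.log (1 - x)) ^ m / x) * Real.exp (t * Real.log x)) (Ioo 0 1) := by
  have h := (beta_aux (t + m) (1/2) (by linarith) (by norm_num)).1.const_mul ((2 * m + 2) ^ m)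
  refine Integrable.mono' h (by measurability) ?_
  rw [ae_restrict_iff' measurableSet_Ioo]
  refine Eventually.of_forall fun x hx => ?_
  have hx0 : 0 < x := hx.1
  have hx1 : 0 < 1 - x := by linarith [hx.2]
  obtain ⟨h1, h2⟩ := log_bd m x hx
  rw [Real.norm_of_nonneg (by positivity)]
  have e1 : Real.exp (t * Real.log x) * x ^ m = Real.exp ((t + m) * Real.log x) := by
    rw [add_mul, Real.exp_add, Real.exp_nat_mul, Real.exp_log hx0]
  have e2 : Real.exp (-(1/2) * Real.log (1 - x)) = Real.exp (1/2 * Real.log (1 - x)) / (1 - x) := by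
    rw [eq_div_iff hx1.ne']
    nth_rw 2 [← Real.exp_log hx1]
    rw [← Real.exp_add]; congr 1; ring
  calc _ ≤ ((2 * m + 2) ^ m * (x ^ m * Real.exp (-(1/2) * Real.log (1 - x)))) / x * Real.exp (t * Real.log x) := by gcongr
    _ = _ := by
      rw [← e1, e2]; field_simp

lemma HH_main (m : ℕ) (t : ℝ) (ht : -(m:ℝ) < t) :
    AnalyticAt ℝ (HH m) t ∧ ∀ n : ℕ, iteratedDeriv n (HH m) t =
       ∫ x in Ioo (0:ℝ) 1, ((-Real.log (1 - x)) ^ m / x) * (Real.log x ^ n * Real.exp (t * Real.log x)) ∧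
       IntegrableOn (fun x => ((-Real.log (1 - x)) ^ m / x) * (Real.log x ^ n * Real.exp (t * Real.log x))) (Ioo 0 1) := by
  refine mgf_aux (fun x => (-Real.log (1 - x)) ^ m / x) Real.log (by fun_prop) ?_ (-(m:ℝ)) ?_ t ht
  · intro x hx
    have hx0 : 0 < x := hx.1
    have := (log_bd m x hx).1
    positivity
  · exact fun t ht => HH_int m t ht

lemma BB_main (a : ℝ) (ha : 0 < a) (b : ℝ) (hb : 0 < b) :
    AnalyticAt ℝ (BB a) b ∧ ∀ n : ℕ, iteratedDeriv n (BB a) b =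
       ∫ x in Ioo (0:ℝ) 1, (Real.exp (a * Real.log x) / (x * (1 - x))) * (Real.log (1 - x) ^ n * Real.exp (b * Real.log (1 - x))) := by
  have := mgf_aux (fun x => (Real.exp (a * Real.log x) / (x * (1 - x)))) (fun x => Real.log (1 - x)) (by fun_prop) ?_ 0 ?_ b hb
  · exact ⟨this.1, fun n => (this.2 n).1⟩
  · intro x hx
    have hx0 : 0 < x := hx.1
    have hx1 : 0 < 1 - x := by linarith [hx.2]
    positivity
  · exact fun t ht => (beta_aux a t ha ht).1

lemma BB_HH (a : ℝ) (ha : 0 < a) (m : ℕ) : iteratedDeriv m (BB a) 1 = (-1) ^ m * HH m a := by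
  rw [(BB_main a ha 1 one_pos).2, HH, ← integral_const_mul]
  refine setIntegral_congr_fun measurableSet_Ioo fun x hx => ?_
  have hx0 : 0 < x := hx.1
  have hx1 : 0 < 1 - x := by linarith [hx.2]
  simp only [one_mul, Real.exp_log hx1, neg_pow (Real.log (1 - x)) m]
  have : ((-1:ℝ)) ^ m * (-1) ^ m = 1 := by rw [← mul_pow]; simp
  field_simp
  linear_combination (- Real.log (1 - x) ^ m) * this

noncomputable abbrev AA : Subalgebra ℚ ℝ := Algebra.adjoin ℚ
        {x : ℝ | ∃ k : ℕ, 2 ≤ k ∧ x = ∑' ℓ : ℕ, 1 / ((ℓ : ℝ) + 1) ^ k}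

lemma AA_rat (q : ℚ) : (q : ℝ) ∈ AA := by
  have := AA.algebraMap_mem q
  simpa using this

lemma AA_inv_nat (p : ℕ) : ((p : ℝ))⁻¹ ∈ AA := by
  have := AA_rat ((p:ℚ)⁻¹)
  push_cast at this; exact this

noncomputable def ps (x : ℝ) : ℝ := deriv Real.Gamma x / Real.Gamma x

lemma Gamma_an (x : ℝ) (hx : 0 < x) : AnalyticAt ℝ Real.Gamma x := by
  have h1 : DifferentiableOn ℂ Complex.Gamma {z | 0 < z.re} := by
    intro z hz
    refine (Complex.differentiableAt_Gamma z fun m hm => ?_).differentiableWithinAt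
    rw [hm] at hz
    simp at hz
    have : (0:ℝ) ≤ m := by positivity
    linarith
  have h2 : AnalyticAt ℂ Complex.Gamma (x:ℂ) :=
    h1.analyticAt ((isOpen_lt continuous_const Complex.continuous_re).mem_nhds (by simpa))
  exact h2.re_ofReal

lemma ps_an (x : ℝ) (hx : 0 < x) : AnalyticAt ℝ ps x :=
  (Gamma_an x hx).deriv.div (Gamma_an x hx) (Real.Gamma_pos_of_pos hx).ne'

lemma ps_add_one (x : ℝ) (hx : 0 < x) : ps (x + 1) = ps x + x⁻¹ := by
  have h : (fun y => Real.Gamma (y + 1)) =ᶠ[𝓝 x] fun y => y * Real.Gamma y := by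
    filter_upwards [lt_mem_nhds hx] with y hy using Real.Gamma_add_one hy.ne'
  have h2 := h.deriv_eq
  rw [deriv_comp_add_const] at h2
  have h3 : deriv (fun y => y * Real.Gamma y) x = Real.Gamma x + x * deriv Real.Gamma x := by
    rw [deriv_fun_mul differentiableAt_fun_id (Gamma_an x hx).differentiableAt]; simp
  rw [ps, ps, h2, h3, Real.Gamma_add_one hx.ne']
  have := (Real.Gamma_pos_of_pos hx).ne'
  field_simp
  ring

def Good (f : ℝ → ℝ) : Prop := (∀ x > -1, AnalyticAt ℝ f x) ∧ ∀ p k : ℕ, iteratedDeriv k f p ∈ AA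

lemma neg_one_lt_nat (p : ℕ) : (p:ℝ) > -1 := by
  have : (0:ℝ) ≤ p := by positivity
  linarith

lemma Good.mul {f g : ℝ → ℝ} (hf : Good f) (hg : Good g) : Good (fun x => f x * g x) := by
  refine ⟨fun x hx => (hf.1 x hx).mul (hg.1 x hx), fun p k => ?_⟩
  rw [iteratedDeriv_fun_mul (hf.1 p (neg_one_lt_nat p)).contDiffAt (hg.1 p (neg_one_lt_nat p)).contDiffAt]
  refine sum_mem fun i _ => mul_mem (mul_mem (natCast_mem _ _) (hf.2 _ _)) (hg.2 _ _)

lemma Good.sum {ι : Type} {s : Finset ι} {f : ι → ℝ → ℝ} (hf : ∀ i ∈ s, Good (f i)) : Good (fun x => ∑ i ∈ s, f i x) := by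
  refine ⟨fun x hx => Finset.analyticAt_fun_sum s fun i hi => (hf i hi).1 x hx, fun p k => ?_⟩
  rw [iteratedDeriv_fun_sum fun i hi => ((hf i hi).1 p (neg_one_lt_nat p)).contDiffAt]
  exact sum_mem fun i hi => (hf i hi).2 _ _

lemma Good.const (c : ℝ) (hc : c ∈ AA) : Good (fun _ => c) := by
  refine ⟨fun x hx => analyticAt_const, fun p k => ?_⟩
  rw [iteratedDeriv_const]
  split_ifs
  · exact hc
  · exact zero_mem _

lemma iter_inv (k : ℕ) (x : ℝ) : iteratedDeriv k (fun y : ℝ => y⁻¹) x = (-1) ^ k * k.factorial * (x⁻¹) ^ (k + 1) := by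
  rw [iteratedDeriv_eq_iterate, iter_deriv_inv]
  congr 1
  rw [← zpow_natCast, inv_zpow, ← zpow_neg]
  congr 1
  push_cast; ring

lemma HH_zero (a : ℝ) (ha : 0 < a) : HH 0 a = a⁻¹ := by
  have h := BB_HH a ha 0
  simp at h
  rw [← h, BB, (beta_aux a 1 ha one_pos).2, Real.Gamma_add_one ha.ne']
  have := (Real.Gamma_pos_of_pos ha).ne'
  simp
  field_simp

lemma HH_zero_iter (k : ℕ) (a : ℝ) (ha : 0 < a) : iteratedDeriv k (HH 0) a = (-1) ^ k * k.factorial * (a⁻¹) ^ (k + 1) := by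
  rw [← iter_inv]
  refine Filter.EventuallyEq.iteratedDeriv_eq k ?_
  filter_upwards [lt_mem_nhds ha] with y hy using HH_zero y hy

lemma int_pow_log (k l : ℕ) :
    IntegrableOn (fun x => x ^ l * Real.log x ^ k) (Ioo 0 1) ∧
    ∫ x in Ioo (0:ℝ) 1, x ^ l * Real.log x ^ k = (-1) ^ k * k.factorial * (((l:ℝ) + 1)⁻¹) ^ (k + 1) := by
  have hl : (0:ℝ) < (l:ℝ) + 1 := by positivity
  obtain ⟨h1, h2⟩ := (HH_main 0 ((l:ℝ) + 1) (by simpa)).2 k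
  rw [HH_zero_iter k _ hl] at h1
  have hE : EqOn (fun x => ((-Real.log (1 - x)) ^ 0 / x) * (Real.log x ^ k * Real.exp (((l:ℝ)+1) * Real.log x)))
     (fun x => x ^ l * Real.log x ^ k) (Ioo 0 1) := by
    intro x hx
    have hx0 : 0 < x := hx.1
    simp only [add_mul, Real.exp_add, one_mul, Real.exp_log hx0, Real.exp_nat_mul]
    field_simp
  rw [setIntegral_congr_fun measurableSet_Ioo hE] at h1
  exact ⟨(integrableOn_congr_fun hE measurableSet_Ioo).1 h2, h1.symm⟩

lemma zeta_int (k : ℕ) : iteratedDeriv k (HH 1) 0 ∈ AA := by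
  rw [((HH_main 1 0 (by simp)).2 k).1]
  have hi : ∀ l : ℕ, Integrable (fun x => ((l:ℝ)+1)⁻¹ * (x ^ l * Real.log x ^ k)) (volume.restrict (Ioo (0:ℝ) 1)) :=
    fun l => (int_pow_log k l).1.const_mul _
  have hz : Summable fun l : ℕ => 1 / ((l:ℝ) + 1) ^ (k + 2) := by
    have := (summable_nat_add_iff 1).2 (Real.summable_one_div_nat_pow (p := k + 2) |>.2 (by omega))
    simpa using this
  have hval : ∀ l : ℕ, ∫ x in Ioo (0:ℝ) 1, ((l:ℝ)+1)⁻¹ * (x ^ l * Real.log x ^ k) =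
      (-1) ^ k * k.factorial * (1 / ((l:ℝ) + 1) ^ (k + 2)) := by
    intro l
    rw [integral_const_mul, (int_pow_log k l).2, one_div, ← inv_pow, pow_succ _ (k + 1)]
    ring
  have hn : ∀ l : ℕ, ∫ x in Ioo (0:ℝ) 1, ‖((l:ℝ)+1)⁻¹ * (x ^ l * Real.log x ^ k)‖ =
      k.factorial * (1 / ((l:ℝ) + 1) ^ (k + 2)) := by
    intro l
    have : EqOn (fun x : ℝ => ‖((l:ℝ)+1)⁻¹ * (x ^ l * Real.log x ^ k)‖) (fun x => (-1) ^ k * (((l:ℝ)+1)⁻¹ * (x ^ l * Real.log x ^ k))) (Ioo 0 1) := by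
      intro x hx
      have hx0 : 0 < x := hx.1
      have hlog : Real.log x ≤ 0 := Real.log_nonpos hx0.le hx.2.le
      simp only [norm_mul, norm_pow, norm_inv, Real.norm_eq_abs, abs_of_pos hx0, abs_of_nonpos hlog]
      rw [abs_of_pos (by positivity), neg_pow]
      ring
    rw [setIntegral_congr_fun measurableSet_Ioo this, integral_const_mul, hval]
    have : ((-1:ℝ)) ^ k * (-1) ^ k = 1 := by rw [← mul_pow]; simp
    linear_combination (k.factorial * (1 / ((l:ℝ) + 1) ^ (k + 2))) * this
  have hs := hasSum_integral_of_summable_integral_norm hi (by simp_rw [hn]; exact hz.mul_left _)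
  simp_rw [hval] at hs
  have h2 := (hz.hasSum.mul_left ((-1) ^ k * (k.factorial:ℝ))).unique hs
  have hE : EqOn (fun x => ((-Real.log (1 - x)) ^ 1 / x) * (Real.log x ^ k * Real.exp (0 * Real.log x)))
     (fun x => ∑' l : ℕ, ((l:ℝ)+1)⁻¹ * (x ^ l * Real.log x ^ k)) (Ioo 0 1) := by
    intro x hx
    have hx0 : 0 < x := hx.1
    have h := Real.hasSum_pow_div_log_of_abs_lt_one (x := x) (by rw [abs_of_pos hx0]; exact hx.2)
    have h3 := h.mul_right (x⁻¹ * Real.log x ^ k)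
    simp only
    refine Eq.trans ?_ (Eq.trans h3.tsum_eq.symm ?_)
    · simp; ring
    · refine tsum_congr fun l => ?_
      rw [pow_succ]
      field_simp
  rw [setIntegral_congr_fun measurableSet_Ioo hE, ← h2]
  refine mul_mem (mul_mem (pow_mem (neg_mem (one_mem _)) _) (natCast_mem _ _)) (Algebra.subset_adjoin ⟨k + 2, by omega, rfl⟩)

lemma eq_ext {f g : ℝ → ℝ} (hf : ∀ x > -1, AnalyticAt ℝ f x) (hg : ∀ x > -1, AnalyticAt ℝ g x)
    (h : ∀ x > 0, f x = g x) : EqOn f g (Ioi (-1)) := by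
  refine AnalyticOnNhd.eqOn_of_preconnected_of_eventuallyEq (𝕜 := ℝ) (z₀ := 1) (fun x hx => hf x hx) (fun x hx => hg x hx)
    isPreconnected_Ioi (by simp) ?_
  filter_upwards [lt_mem_nhds one_pos] with y hy using h y hy

lemma BB_deriv (a : ℝ) (ha : 0 < a) (b : ℝ) (hb : 0 < b) : deriv (BB a) b = BB a b * (ps b - ps (a + b)) := by
  have hE : BB a =ᶠ[𝓝 b] fun b => Real.Gamma a * Real.Gamma b / Real.Gamma (a + b) := by
    filter_upwards [lt_mem_nhds hb] with y hy using (beta_aux a y ha hy).2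
  rw [hE.deriv_eq, hE.eq_of_nhds]
  have h1 := (Gamma_an b hb).differentiableAt.hasDerivAt
  have h2 := (Gamma_an (a + b) (by linarith)).differentiableAt.hasDerivAt.comp_const_add a b
  have p1 := (Real.Gamma_pos_of_pos hb).ne'
  have p2 := (Real.Gamma_pos_of_pos (show 0 < a + b by linarith)).ne'
  rw [((h1.const_mul (Real.Gamma a)).fun_div h2 p2).deriv, ps, ps]
  field_simp

lemma BB_rec (a : ℝ) (ha : 0 < a) (m : ℕ) : iteratedDeriv (m + 1) (BB a) 1 =
    ∑ j ∈ Finset.range (m + 1), (m.choose j : ℝ) * iteratedDeriv j (BB a) 1 *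
      (iteratedDeriv (m - j) ps 1 - iteratedDeriv (m - j) ps (a + 1)) := by
  have hE : deriv (BB a) =ᶠ[𝓝 1] fun b => BB a b * (ps b - ps (a + b)) := by
    filter_upwards [lt_mem_nhds one_pos] with y hy using BB_deriv a ha y hy
  have c1 : AnalyticAt ℝ ps 1 := ps_an 1 one_pos
  have c2 : AnalyticAt ℝ (fun b => ps (a + b)) 1 := by
    have := ps_an (a + 1) (by linarith)
    exact AnalyticAt.fun_comp this (by fun_prop)
  rw [iteratedDeriv_succ', hE.iteratedDeriv_eq,
    iteratedDeriv_fun_mul (BB_main a ha 1 one_pos).1.contDiffAt (c1.fun_sub c2).contDiffAt]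
  refine Finset.sum_congr rfl fun j _ => ?_
  rw [iteratedDeriv_fun_sub c1.contDiffAt c2.contDiffAt, iteratedDeriv_comp_const_add]

lemma iter_id_mul (f : ℝ → ℝ) (x : ℝ) (hf : AnalyticAt ℝ f x) (n : ℕ) :
    iteratedDeriv (n + 1) (fun y => y * f y) x = x * iteratedDeriv (n + 1) f x + (n + 1) * iteratedDeriv n f x := by
  have h2 : ∀ k, iteratedDeriv (k + 2) (fun y : ℝ => y) x = 0 := by
    intro k
    rw [iteratedDeriv_succ', iteratedDeriv_succ']
    simp
  rw [iteratedDeriv_fun_mul (f := fun y : ℝ => y) contDiffAt_id hf.contDiffAt, Finset.sum_range_succ', Finset.sum_range_succ']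
  simp [h2, id_def]
  ring

noncomputable def DD (a : ℝ) : ℝ := a * HH 1 a

lemma HH1_an (a : ℝ) (ha : a > -1) : AnalyticAt ℝ (HH 1) a := (HH_main 1 a (by simpa using ha)).1

lemma DD_an (a : ℝ) (ha : a > -1) : AnalyticAt ℝ DD a := analyticAt_id.mul (HH1_an a ha)

lemma ps_comp_an (a : ℝ) (ha : a > -1) : AnalyticAt ℝ (fun a => ps (a + 1)) a := by
  have := ps_an (a + 1) (by linarith)
  exact AnalyticAt.fun_comp this (by fun_prop)

lemma ps_DD : EqOn (fun a => ps (a + 1)) (fun a => ps 1 + DD a) (Ioi (-1)) := by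
  refine eq_ext ps_comp_an (fun x hx => analyticAt_const.add (DD_an x hx)) fun a ha => ?_
  have h := BB_HH a ha 1
  have h0 := BB_HH a ha 0
  rw [HH_zero a ha] at h0
  rw [iteratedDeriv_one, BB_deriv a ha 1 one_pos] at h
  simp at h h0
  rw [h0] at h
  simp only [DD]
  field_simp at h
  linarith

lemma DD_good : Good DD := by
  refine ⟨DD_an, fun p => ?_⟩
  induction p with
  | zero =>
    intro k
    cases k with
    | zero => simp [DD]
    | succ k =>
      have := iter_id_mul (HH 1) 0 (HH1_an 0 (by simp)) k
      simp only [Nat.cast_zero]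
      change iteratedDeriv (k + 1) (fun y => y * HH 1 y) 0 ∈ AA
      rw [this, zero_mul, zero_add]
      exact mul_mem (add_mem (natCast_mem _ _) (one_mem _)) (zeta_int k)
  | succ p ih =>
    intro k
    have hp := neg_one_lt_nat p
    have hE : (fun a => DD (a + 1)) =ᶠ[𝓝 (p:ℝ)] fun a => DD a + (a + 1)⁻¹ := by
      filter_upwards [lt_mem_nhds hp] with y hy
      have h1 := ps_DD (show y ∈ Ioi (-1:ℝ) from hy)
      have h2 := ps_DD (show y + 1 ∈ Ioi (-1:ℝ) by simp only [mem_Ioi]; linarith)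
      have h3 := ps_add_one (y + 1) (by linarith)
      simp only at h1 h2
      linarith
    have h1 := hE.iteratedDeriv_eq k
    have hinv : AnalyticAt ℝ (fun a : ℝ => (a + 1)⁻¹) (p:ℝ) :=
      AnalyticAt.inv (f := fun a : ℝ => a + 1) (by fun_prop) (by linarith)
    rw [iteratedDeriv_comp_add_const, iteratedDeriv_fun_add (DD_an p hp).contDiffAt hinv.contDiffAt,
      iteratedDeriv_comp_add_const k (fun a : ℝ => a⁻¹)] at h1
    simp only [iter_inv] at h1
    rw [Nat.cast_succ, h1]
    refine add_mem (ih k) (mul_mem (mul_mem (pow_mem (neg_mem (one_mem _)) _) (natCast_mem _ _)) (pow_mem ?_ _))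
    have := AA_inv_nat (p + 1)
    push_cast at this
    exact this

lemma Good.iter {f : ℝ → ℝ} (hf : Good f) (j : ℕ) : Good (iteratedDeriv j f) := by
  refine ⟨fun x hx => ?_, fun p k => ?_⟩
  · rw [iteratedDeriv_eq_iterate]
    exact (hf.1 x hx).iterated_deriv j
  · rw [iteratedDeriv_eq_iterate, iteratedDeriv_eq_iterate, ← Function.iterate_add_apply, ← iteratedDeriv_eq_iterate]
    exact hf.2 _ _

lemma Good.add {f g : ℝ → ℝ} (hf : Good f) (hg : Good g) : Good (fun x => f x + g x) := by
  refine ⟨fun x hx => (hf.1 x hx).add (hg.1 x hx), fun p k => ?_⟩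
  rw [iteratedDeriv_fun_add (hf.1 p (neg_one_lt_nat p)).contDiffAt (hg.1 p (neg_one_lt_nat p)).contDiffAt]
  exact add_mem (hf.2 _ _) (hg.2 _ _)

lemma ps_iter (j : ℕ) (a : ℝ) (ha : a > -1) :
    iteratedDeriv j ps (a + 1) = iteratedDeriv j DD a + if j = 0 then ps 1 else 0 := by
  have hE : (fun a => ps (a + 1)) =ᶠ[𝓝 a] fun a => ps 1 + DD a := by
    filter_upwards [lt_mem_nhds ha] with y hy using ps_DD hy
  have h := hE.iteratedDeriv_eq j
  rw [iteratedDeriv_comp_add_const, iteratedDeriv_fun_add contDiffAt_const (DD_an a ha).contDiffAt, iteratedDeriv_const] at h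
  simp only at h
  rw [h, add_comm]

lemma main_rec (m : ℕ) : ∃ P, Good P ∧ ∀ a > 0, a * iteratedDeriv m (BB a) 1 = P a := by
  induction m using Nat.strong_induction_on with
  | _ m ih =>
    cases m with
    | zero =>
      refine ⟨fun _ => 1, Good.const 1 (one_mem _), fun a ha => ?_⟩
      rw [BB_HH a ha, HH_zero a ha]
      field_simp
    | succ m =>
      choose! P hP hPe using ih
      refine ⟨fun a => ∑ j ∈ Finset.range (m + 1), (m.choose j : ℝ) * P j a *
        (iteratedDeriv (m - j) DD 0 + (-1) * iteratedDeriv (m - j) DD a), ?_, fun a ha => ?_⟩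
      · refine Good.sum fun j hj => ?_
        have hj' : j < m + 1 := Finset.mem_range.1 hj
        refine ((Good.const _ (natCast_mem _ _)).mul (hP j hj')).mul ((Good.const _ ?_).add
          ((Good.const _ (neg_mem (one_mem _))).mul (DD_good.iter _)))
        simpa using DD_good.2 0 (m - j)
      · rw [BB_rec a ha, Finset.mul_sum]
        refine Finset.sum_congr rfl fun j hj => ?_
        have hj' : j < m + 1 := Finset.mem_range.1 hj
        rw [← hPe j hj' a ha, ps_iter _ a (by linarith)]
        have := ps_iter (m - j) 0 (by simp)
        rw [zero_add] at this
        rw [this]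
        ring

lemma HH_mem (m p : ℕ) (hmp : p = 0 → 1 ≤ m) (n : ℕ) : iteratedDeriv n (HH m) p ∈ AA := by
  obtain ⟨P, hP, hPe⟩ := main_rec m
  have hlt : -(m:ℝ) < p := by
    have h : 0 < (m:ℝ) + p := by
      have : 0 < m + p := by omega
      exact_mod_cast this
    linarith
  have han := (HH_main m p hlt).1
  have hsgn : Good (fun a => (-1) ^ m * P a) := (Good.const _ (pow_mem (neg_mem (one_mem _)) _)).mul hP
  have hpos : ∀ a > 0, a * HH m a = (-1) ^ m * P a := by
    intro a ha
    rw [← hPe a ha, BB_HH a ha]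
    have : ((-1:ℝ)) ^ m * (-1) ^ m = 1 := by rw [← mul_pow]; simp
    linear_combination (- a * HH m a) * this
  have hE : (fun a => a * HH m a) =ᶠ[𝓝 (p:ℝ)] fun a => (-1) ^ m * P a := by
    rcases Nat.eq_zero_or_pos m with rfl | hm
    · have hp : 0 < (p:ℝ) := by
        have : 0 < p := by omega
        exact_mod_cast this
      filter_upwards [lt_mem_nhds hp] with y hy using hpos y hy
    · have hm1 : (1:ℝ) ≤ m := by exact_mod_cast hm
      have := eq_ext (f := fun a => a * HH m a) (fun x hx => analyticAt_id.mul (HH_main m x (by linarith)).1) hsgn.1 hpos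
      filter_upwards [lt_mem_nhds (neg_one_lt_nat p)] with y hy using this hy
  have hmem : ∀ k, iteratedDeriv k (fun a => a * HH m a) p ∈ AA := fun k => by
    rw [hE.iteratedDeriv_eq]; exact hsgn.2 p k
  rcases Nat.eq_zero_or_pos p with rfl | hp
  · have h := hmem (n + 1)
    rw [iter_id_mul _ _ han] at h
    have h2 := mul_mem (AA_inv_nat (n + 1)) h
    convert h2 using 1
    push_cast
    field_simp
    ring
  · have hp' : (p:ℝ) ≠ 0 := by positivity
    induction n with
    | zero =>
      have h2 := mul_mem (AA_inv_nat p) (hmem 0)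
      convert h2 using 1
      simp
      field_simp
    | succ n ih =>
      have h := hmem (n + 1)
      rw [iter_id_mul _ _ han] at h
      have h2 := mul_mem (AA_inv_nat p) (sub_mem h (mul_mem (add_mem (natCast_mem _ n) (one_mem _)) ih))
      convert h2 using 1
      field_simp
      ring

/-- The normalized logarithmic integral `S_{n,m}^{(i)}`, for integer `i`, lies in the
ℚ-subalgebra of ℝ generated by the Riemann zeta values `ζ(k)`, `k ≥ 2`,
whenever `i ≥ -1` and `m ≥ 1` if `i = -1`. -/
theorem stmt1 (n m : ℕ) (i : ℤ) (hi : -1 ≤ i) (him : i = -1 → 1 ≤ m) :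
    ((-1 : ℝ) ^ (n + m) / ((n.factorial : ℝ) * m.factorial)) *
      ∫ x in (0:ℝ)..1, x ^ i * Real.log x ^ n * Real.log (1 - x) ^ m
    ∈ Algebra.adjoin ℚ
        {x : ℝ | ∃ k : ℕ, 2 ≤ k ∧ x = ∑' ℓ : ℕ, 1 / ((ℓ : ℝ) + 1) ^ k} := by
  obtain ⟨p, hp⟩ : ∃ p : ℕ, i = (p:ℤ) - 1 := ⟨(i + 1).toNat, by omega⟩
  have hmp : p = 0 → 1 ≤ m := fun h => him (by omega)
  have hlt : -(m:ℝ) < p := by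
    have h : 0 < (m:ℝ) + p := by
      have : 0 < m + p := by omega
      exact_mod_cast this
    linarith
  have hI : ∫ x in (0:ℝ)..1, x ^ i * Real.log x ^ n * Real.log (1 - x) ^ m = (-1) ^ m * iteratedDeriv n (HH m) p := by
    rw [((HH_main m p hlt).2 n).1, ← integral_const_mul, intervalIntegral.integral_of_le zero_le_one,
      integral_Ioc_eq_integral_Ioo]
    refine setIntegral_congr_fun measurableSet_Ioo fun x hx => ?_
    have hx0 : 0 < x := hx.1
    simp only [neg_pow (Real.log (1 - x)) m]
    rw [hp, zpow_sub_one₀ hx0.ne', zpow_natCast, Real.exp_nat_mul, Real.exp_log hx0]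
    have : ((-1:ℝ)) ^ m * (-1) ^ m = 1 := by rw [← mul_pow]; simp
    linear_combination (- x ^ p * x⁻¹ * Real.log x ^ n * Real.log (1 - x) ^ m) * this
  rw [hI, div_eq_mul_inv, mul_inv]
  exact mul_mem (mul_mem (pow_mem (neg_mem (one_mem _)) _) (mul_mem (AA_inv_nat _) (AA_inv_nat _)))
    (mul_mem (pow_mem (neg_mem (one_mem _)) _) (HH_mem m p hmp n))
end

section
/- For all integers n ≥ 0, m ≥ 0 and every integer i with i ≥ −m, the normalized logarithmic integral S_{n,m}^{(i)} belongs to the ℚ-subalgebra of ℝ generated by the Riemann zeta values ζ(2), ζ(3), ζ(4), …; that is, S_{n,m}^{(i)} is a polynomial with rational coefficients in the numbers ∑_{ℓ=1}^{∞} 1/ℓ^k for k ≥ 2. -/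
open Filter Topology

noncomputable abbrev ZA : Subalgebra ℚ ℝ := Algebra.adjoin ℚ
        {x : ℝ | ∃ k : ℕ, 2 ≤ k ∧ x = ∑' ℓ : ℕ, 1 / ((ℓ : ℝ) + 1) ^ k}

lemma ZA_rat (q : ℚ) : (q : ℝ) ∈ ZA := by
  have := ZA.algebraMap_mem q
  simpa using this

lemma ZA_nat (q : ℕ) : (q : ℝ) ∈ ZA := by
  exact_mod_cast ZA_rat q

lemma ZA_int (q : ℤ) : (q : ℝ) ∈ ZA := by
  exact_mod_cast ZA_rat q

lemma taylor_of_hasSum {f : ℝ → ℝ} {a : ℕ → ℝ}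
    (h : ∀ᶠ z in 𝓝 (0:ℝ), HasSum (fun n => a n * z ^ n) (f z)) :
    AnalyticAt ℝ f 0 ∧ ∀ n, iteratedDeriv n f 0 = n.factorial * a n := by
  have h1 : HasFPowerSeriesAt f (FormalMultilinearSeries.ofScalars ℝ a) 0 := by
    rw [hasFPowerSeriesAt_iff]
    filter_upwards [h] with z hz
    simpa [FormalMultilinearSeries.coeff_ofScalars, mul_comm] using hz
  have h2 : AnalyticAt ℝ f 0 := ⟨_, h1⟩
  refine ⟨h2, fun n => ?_⟩
  have h3 := h1.eq_formalMultilinearSeries h2.hasFPowerSeriesAt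
  have h4 : a n = iteratedDeriv n f 0 / n.factorial := by
    have := congrArg (fun p => FormalMultilinearSeries.coeff p n) h3
    simpa only [FormalMultilinearSeries.coeff_ofScalars] using this
  rw [h4]
  have := n.factorial_ne_zero
  field_simp

lemma exp_taylor {W : ℝ → ℝ} (hW : AnalyticAt ℝ W 0) (h0 : W 0 = 0)
    (hA : ∀ n, iteratedDeriv n W 0 ∈ ZA) (n : ℕ) :
    iteratedDeriv n (fun t => Real.exp (W t)) 0 ∈ ZA := by
  have hE : AnalyticAt ℝ (fun t => Real.exp (W t)) 0 := hW.rexp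
  induction n using Nat.strong_induction_on with
  | _ n ih =>
    cases n with
    | zero => simp [h0]
    | succ n =>
      have hd : deriv (fun t => Real.exp (W t)) =ᶠ[𝓝 0] fun t => Real.exp (W t) * deriv W t := by
        filter_upwards [hW.eventually_analyticAt] with t ht
        exact (ht.differentiableAt.hasDerivAt.exp).deriv
      rw [iteratedDeriv_succ', hd.iteratedDeriv_eq,
        iteratedDeriv_fun_mul hE.contDiffAt hW.deriv.contDiffAt]
      refine ZA.sum_mem fun i hi => ZA.mul_mem (ZA.mul_mem (ZA_nat _) (ih i ?_)) ?_
      · simpa using hi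
      · rw [← iteratedDeriv_succ']
        exact hA _

lemma zeta_mem {k : ℕ} (hk : 2 ≤ k) : (∑' ℓ : ℕ, 1 / ((ℓ : ℝ) + 1) ^ k) ∈ ZA :=
  Algebra.subset_adjoin ⟨k, hk, rfl⟩

lemma zeta_hasSum {k : ℕ} (hk : 2 ≤ k) :
    HasSum (fun ℓ : ℕ => 1 / ((ℓ : ℝ) + 1) ^ k) (∑' ℓ : ℕ, 1 / ((ℓ : ℝ) + 1) ^ k) := by
  apply Summable.hasSum
  have := (summable_nat_add_iff 1).2 (Real.summable_one_div_nat_pow.2 (show 1 < k by omega))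
  simpa using this

lemma log_term {y : ℝ} (hy : |y| < 1) :
    HasSum (fun j : ℕ => (-y) ^ (j + 2) / ((j : ℝ) + 2)) (y - Real.log (1 + y)) := by
  have h := Real.hasSum_pow_div_log_of_abs_lt_one (x := -y) (by simpa using hy)
  rw [← hasSum_nat_add_iff' 1] at h
  convert! h using 1
  · funext j; push_cast; ring_nf
  · simp; ring

lemma logGamma_tendsto {t : ℝ} (ht : |t| < 1) :
    Tendsto (fun n : ℕ => ∑ k ∈ Finset.range n, (t / (k + 1) - Real.log (1 + t / (k + 1)))) atTop
      (𝓝 (Real.log (Real.Gamma (1 + t)) + Real.eulerMascheroniConstant * t)) := by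
  have ht' := abs_lt.1 ht
  have h1 := Real.BohrMollerup.tendsto_log_gamma (x := 1 + t) (by linarith)
  have h2 := Real.tendsto_harmonic_sub_log.mul_const t
  have h3 := (Real.tendsto_log_comp_add_sub_log (1 + t)).comp (tendsto_natCast_atTop_atTop (R := ℝ))
  have h4 := (h1.add h2).add h3
  rw [add_zero] at h4
  refine h4.congr' ?_
  filter_upwards [eventually_gt_atTop 0] with n hn
  have e1 : Real.log (n.factorial) = ∑ k ∈ Finset.range n, Real.log ((k : ℝ) + 1) := by
    clear hn
    induction n with
    | zero => simp
    | succ n ih =>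
      rw [Nat.factorial_succ, Finset.sum_range_succ, ← ih]
      push_cast
      rw [Real.log_mul (by positivity) (by positivity)]; ring
  have e2 : ((harmonic n : ℚ) : ℝ) = ∑ k ∈ Finset.range n, 1 / ((k : ℝ) + 1) := by
    simp [harmonic]
  have e3 : ∀ k : ℕ, Real.log (1 + t / (k + 1)) = Real.log (1 + t + k) - Real.log (k + 1) := by
    intro k
    have hk : (0:ℝ) < k + 1 := by positivity
    have hk0 : (0:ℝ) ≤ k := by positivity
    rw [← Real.log_div (by linarith) hk.ne']
    congr 1
    field_simp; ring
  simp only [Real.BohrMollerup.logGammaSeq, Function.comp, e1, e2, e3, Finset.sum_range_succ,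
    Finset.sum_sub_distrib, sub_mul, Finset.sum_mul]
  have e4 : ∀ k : ℕ, 1 / ((k:ℝ) + 1) * t = t / (k + 1) := fun k => by ring
  simp only [e4]
  rw [add_comm (n : ℝ) (1 + t)]
  ring

lemma logGamma_hasSum {t : ℝ} (ht : |t| < 1) :
    HasSum (fun j : ℕ => (-t) ^ (j + 2) / ((j : ℝ) + 2) * ∑' ℓ : ℕ, 1 / ((ℓ : ℝ) + 1) ^ (j + 2))
      (Real.log (Real.Gamma (1 + t)) + Real.eulerMascheroniConstant * t) := by
  let f : ℕ × ℕ → ℝ := fun p => (-(t / (p.1 + 1))) ^ (p.2 + 2) / ((p.2 : ℝ) + 2)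
  have hf : Summable f := by
    have s1 : Summable (fun k : ℕ => 1 / ((k : ℝ) + 1) ^ 2) := (zeta_hasSum le_rfl).summable
    have s2 : Summable (fun j : ℕ => |t| ^ j) := summable_geometric_of_lt_one (abs_nonneg _) ht
    refine Summable.of_norm_bounded
      (s1.mul_of_nonneg s2 (fun k => by positivity) (fun j => by positivity)) ?_
    rintro ⟨k, j⟩
    simp only [f, norm_div, norm_pow, norm_neg, Real.norm_eq_abs]
    have hk : (1:ℝ) ≤ k + 1 := by simp
    rw [abs_of_pos (show (0:ℝ) < k + 1 by positivity), abs_of_pos (show (0:ℝ) < j + 2 by positivity)]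
    calc (|t| / (k + 1)) ^ (j + 2) / ((j : ℝ) + 2) ≤ (|t| / (k + 1)) ^ (j + 2) := by
          apply div_le_self (by positivity)
          linarith [(Nat.cast_nonneg j : (0:ℝ) ≤ j)]
      _ = (|t| / (k+1)) ^ 2 * (|t| / (k+1)) ^ j := by ring
      _ ≤ (1 / (k+1)) ^ 2 * |t| ^ j := by
          gcongr
          exact div_le_self (abs_nonneg _) hk
      _ = _ := by simp
  have h1 : ∀ k : ℕ, HasSum (fun j => f (k, j)) (t / (k + 1) - Real.log (1 + t / (k + 1))) := by
    intro k
    refine log_term (y := t / (k + 1)) ?_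
    have hk : (1:ℝ) ≤ k + 1 := by simp
    rw [abs_div, abs_of_pos (show (0:ℝ) < k + 1 by positivity)]
    exact (div_le_self (abs_nonneg _) hk).trans_lt ht
  have h2 : ∀ j : ℕ, HasSum (fun k => f (k, j))
      ((-t) ^ (j + 2) / ((j : ℝ) + 2) * ∑' ℓ : ℕ, 1 / ((ℓ : ℝ) + 1) ^ (j + 2)) := by
    intro j
    convert! (zeta_hasSum (show 2 ≤ j + 2 by omega)).mul_left ((-t) ^ (j + 2) / ((j : ℝ) + 2)) using 2 with k
    simp only [f]
    rw [← neg_div, div_pow]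
    ring
  have h3 := hf.hasSum.prod_fiberwise h1
  have h4 := tendsto_nhds_unique h3.tendsto_sum_nat (logGamma_tendsto ht)
  rw [← h4]
  have h5 : HasSum (f ∘ Prod.swap) (∑' b, f b) :=
    (Equiv.prodComm ℕ ℕ).hasSum_iff.2 hf.hasSum
  exact h5.prod_fiberwise h2

noncomputable def gcoef (j : ℕ) : ℝ :=
  if j < 2 then 0 else (-1) ^ j / (j : ℝ) * ∑' ℓ : ℕ, 1 / ((ℓ : ℝ) + 1) ^ j

lemma gcoef_mem (j : ℕ) : gcoef j ∈ ZA := by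
  unfold gcoef
  split_ifs with h
  · exact ZA.zero_mem
  · refine ZA.mul_mem ?_ (zeta_mem (by omega))
    have := ZA_rat ((-1) ^ j / (j : ℚ))
    push_cast at this
    exact this

lemma logGamma_hasSum' {t : ℝ} (ht : |t| < 1) :
    HasSum (fun j : ℕ => gcoef j * t ^ j)
      (Real.log (Real.Gamma (1 + t)) + Real.eulerMascheroniConstant * t) := by
  rw [← hasSum_nat_add_iff' 2]
  convert! logGamma_hasSum ht using 1
  · funext j
    simp only [gcoef]
    rw [if_neg (by omega)]
    push_cast
    rw [neg_pow t]
    ring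
  · simp [Finset.sum_range_succ, gcoef]

lemma log_hasSum' {t : ℝ} (ht : |t| < 1) :
    HasSum (fun j : ℕ => (-1) ^ j / (j : ℝ) * t ^ j) (-Real.log (1 + t)) := by
  have h := Real.hasSum_pow_div_log_of_abs_lt_one (x := -t) (by simpa using ht)
  rw [← hasSum_nat_add_iff' 1]
  convert! h using 1
  · funext j
    push_cast
    rw [neg_pow t]
    ring
  · simp

open MeasureTheory ProbabilityTheory

noncomputable abbrev mu : Measure ℝ := volume.restrict (Set.Ioo (0:ℝ) 1)

noncomputable def XX (s x : ℝ) : ℝ := s * Real.log x + Real.log (1 - x)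

lemma exp_XX {s t x : ℝ} (hx : x ∈ Set.Ioo (0:ℝ) 1) :
    Real.exp (t * XX s x) =
      (((x : ℂ) ^ (((1 + s * t : ℝ) : ℂ) - 1) * (1 - (x : ℂ)) ^ (((1 + t : ℝ) : ℂ) - 1))).re := by
  have h0 := hx.1
  have h1 : 0 < 1 - x := by linarith [hx.2]
  have e1 : ((1 + s * t : ℝ) : ℂ) - 1 = ((s * t : ℝ) : ℂ) := by push_cast; ring
  have e2 : ((1 + t : ℝ) : ℂ) - 1 = ((t : ℝ) : ℂ) := by push_cast; ring
  have e3 : (1 - (x : ℂ)) = ((1 - x : ℝ) : ℂ) := by push_cast; ring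
  rw [e1, e2, e3, ← Complex.ofReal_cpow h0.le, ← Complex.ofReal_cpow h1.le, ← Complex.ofReal_mul,
    Complex.ofReal_re, Real.rpow_def_of_pos h0, Real.rpow_def_of_pos h1, ← Real.exp_add]
  congr 1
  unfold XX
  ring

lemma beta_integrable {s t : ℝ} (h1 : 0 < 1 + s * t) (h2 : 0 < 1 + t) :
    Integrable (fun x : ℝ => ((x : ℂ) ^ (((1 + s * t : ℝ) : ℂ) - 1) *
      (1 - (x : ℂ)) ^ (((1 + t : ℝ) : ℂ) - 1))) mu := by
  have := Complex.betaIntegral_convergent (u := ((1 + s * t : ℝ) : ℂ)) (v := ((1 + t : ℝ) : ℂ))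
    (by rw [Complex.ofReal_re]; exact h1) (by rw [Complex.ofReal_re]; exact h2)
  rw [intervalIntegrable_iff_integrableOn_Ioo_of_le zero_le_one] at this
  exact this

lemma exp_integrable {s t : ℝ} (h1 : 0 < 1 + s * t) (h2 : 0 < 1 + t) :
    Integrable (fun x => Real.exp (t * XX s x)) mu := by
  refine (beta_integrable h1 h2).re.congr ?_
  filter_upwards [ae_restrict_mem measurableSet_Ioo] with x hx
  exact (exp_XX hx).symm

lemma mgf_XX {s t : ℝ} (h1 : 0 < 1 + s * t) (h2 : 0 < 1 + t) :
    mgf (XX s) mu t = Real.Gamma (1 + s * t) * Real.Gamma (1 + t) / Real.Gamma ((1 + s * t) + (1 + t)) := by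
  have e := beta_eq_betaIntegralReal _ _ h1 h2
  rw [beta] at e
  rw [e, Complex.betaIntegral, intervalIntegral.integral_of_le zero_le_one,
    integral_Ioc_eq_integral_Ioo, mgf, ← RCLike.re_to_complex, ← integral_re (beta_integrable h1 h2)]
  refine setIntegral_congr_fun measurableSet_Ioo fun x hx => ?_
  exact exp_XX hx

lemma small_pos {c s t : ℝ} (hs : 0 ≤ s) (hsc : s ≤ c) (h : |c * t| < 1) : |s * t| < 1 := by
  rw [abs_mul] at *
  refine lt_of_le_of_lt ?_ h
  gcongr

lemma ev_small (c : ℝ) : ∀ᶠ t in 𝓝 (0:ℝ), |c * t| < 1 := by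
  have : Tendsto (fun t : ℝ => |c * t|) (𝓝 0) (𝓝 (|c * 0|)) := by
    apply Continuous.tendsto
    fun_prop
  rw [mul_zero, abs_zero] at this
  exact this.eventually (gt_mem_nhds zero_lt_one)

lemma zero_mem_int {s : ℝ} (hs : 0 ≤ s) : (0:ℝ) ∈ interior (integrableExpSet (XX s) mu) := by
  rw [mem_interior_iff_mem_nhds]
  filter_upwards [ev_small (s + 1)] with t ht
  have h1 := abs_lt.1 (small_pos hs (by linarith) ht)
  have h2 := abs_lt.1 (small_pos zero_le_one (by linarith) ht)
  exact exp_integrable (by linarith) (by linarith)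

noncomputable def lG (t : ℝ) : ℝ := Real.log (Real.Gamma (1 + t)) + Real.eulerMascheroniConstant * t

noncomputable def WW (s t : ℝ) : ℝ := lG (s * t) + lG t - lG ((s + 1) * t) - Real.log (1 + (s + 1) * t)

lemma mgf_exp {s t : ℝ} (hs : 0 ≤ s) (ht : |(s + 1) * t| < 1) :
    mgf (XX s) mu t = Real.exp (WW s t) := by
  have h0 := abs_lt.1 ht
  have h1 := abs_lt.1 (small_pos hs (by linarith) ht)
  have h2 := abs_lt.1 (small_pos zero_le_one (by linarith) ht)
  rw [one_mul] at h2
  have p1 : 0 < 1 + s * t := by linarith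
  have p2 : 0 < 1 + t := by linarith
  have p0 : 0 < 1 + (s + 1) * t := by linarith
  rw [mgf_XX p1 p2]
  have e1 : (1 + s * t) + (1 + t) = (1 + (s + 1) * t) + 1 := by ring
  have e2 : WW s t = Real.log (Real.Gamma (1 + s * t)) + Real.log (Real.Gamma (1 + t))
      - Real.log (Real.Gamma (1 + (s + 1) * t)) - Real.log (1 + (s + 1) * t) := by
    unfold WW lG; ring
  rw [e1, Real.Gamma_add_one p0.ne', e2, Real.exp_sub, Real.exp_sub, Real.exp_add,
    Real.exp_log (Real.Gamma_pos_of_pos p1), Real.exp_log (Real.Gamma_pos_of_pos p2),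
    Real.exp_log (Real.Gamma_pos_of_pos p0), Real.exp_log p0]
  rw [div_div, mul_comm (1 + (s + 1) * t)]

lemma moment_mem (s : ℕ) (n : ℕ) : ∫ x, XX s x ^ n ∂mu ∈ ZA := by
  have hs : (0:ℝ) ≤ s := by positivity
  have hz := iteratedDeriv_mgf_zero (zero_mem_int hs) n
  simp only [Pi.pow_apply] at hz
  rw [← hz]
  have he : mgf (XX s) mu =ᶠ[𝓝 0] fun t => Real.exp (WW s t) := by
    filter_upwards [ev_small ((s:ℝ) + 1)] with t ht
    exact mgf_exp hs ht
  rw [he.iteratedDeriv_eq]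
  have hW := taylor_of_hasSum (f := WW s) (a := fun j => gcoef j * (s:ℝ) ^ j + gcoef j
      - gcoef j * ((s:ℝ) + 1) ^ j + (-1) ^ j / (j : ℝ) * ((s:ℝ) + 1) ^ j) (by
    filter_upwards [ev_small ((s:ℝ) + 1)] with t ht
    have h1 := small_pos hs (by linarith) ht
    have h2 := small_pos zero_le_one (by linarith) ht
    rw [one_mul] at h2
    have := (((logGamma_hasSum' h1).add (logGamma_hasSum' h2)).sub (logGamma_hasSum' ht)).add
      (log_hasSum' ht)
    convert! this using 1
    funext j
    simp only [mul_pow]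
    ring)
  refine exp_taylor hW.1 (by simp [WW, lG]) (fun j => ?_) n
  rw [hW.2]
  refine ZA.mul_mem (ZA_nat _) (ZA.add_mem (ZA.sub_mem (ZA.add_mem (ZA.mul_mem (gcoef_mem _) ?_)
    (gcoef_mem _)) (ZA.mul_mem (gcoef_mem _) ?_)) ?_)
  · exact ZA.pow_mem (ZA_nat _) _
  · exact ZA.pow_mem (ZA.add_mem (ZA_nat _) ZA.one_mem) _
  · have := ZA_rat ((-1) ^ j / (j : ℚ) * (s + 1) ^ j)
    push_cast at this
    exact this

lemma vander {N : ℕ} (a : Fin (N + 1) → ℝ)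
    (h : ∀ s : ℕ, ∑ k : Fin (N + 1), (s : ℝ) ^ (k : ℕ) * a k ∈ ZA) (n : Fin (N + 1)) : a n ∈ ZA := by
  let V : Matrix (Fin (N + 1)) (Fin (N + 1)) ℚ := Matrix.vandermonde (fun k => ((k : ℕ) : ℚ))
  have hV : V.det ≠ 0 := by
    rw [Matrix.det_vandermonde_ne_zero_iff]
    intro a b hab
    simpa [Fin.ext_iff] using hab
  have hI : V⁻¹ * V = 1 := Matrix.nonsing_inv_mul _ (isUnit_iff_ne_zero.2 hV)
  have key : a n = ∑ s : Fin (N + 1), ((V⁻¹ n s : ℚ) : ℝ) *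
      ∑ k : Fin (N + 1), ((s : ℕ) : ℝ) ^ (k : ℕ) * a k := by
    simp_rw [Finset.mul_sum]
    rw [Finset.sum_comm]
    have : ∀ k : Fin (N + 1), ∑ s : Fin (N + 1), ((V⁻¹ n s : ℚ) : ℝ) * (((s : ℕ) : ℝ) ^ (k : ℕ) * a k)
        = (((1 : Matrix (Fin (N + 1)) (Fin (N + 1)) ℚ) n k : ℚ) : ℝ) * a k := by
      intro k
      rw [← hI, Matrix.mul_apply]
      push_cast
      rw [Finset.sum_mul]
      refine Finset.sum_congr rfl fun s _ => ?_
      simp [V, Matrix.vandermonde_apply, mul_assoc]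
    rw [Finset.sum_congr rfl fun k _ => this k]
    rw [Finset.sum_eq_single n]
    · simp
    · intro b _ hb
      rw [Matrix.one_apply_ne hb.symm]
      simp
    · simp
  rw [key]
  exact ZA.sum_mem fun s _ => ZA.mul_mem (ZA_rat _) (h s)

noncomputable def ww (n m : ℕ) (i : ℤ) (x : ℝ) : ℝ := x ^ i * Real.log x ^ n * Real.log (1 - x) ^ m

noncomputable def JJ (n m : ℕ) (i : ℤ) : ℝ := ∫ x in (0:ℝ)..1, ww n m i x

lemma abs_XX {x : ℝ} (hx : x ∈ Set.Ioo (0:ℝ) 1) : |XX 1 x| = |Real.log x| + |Real.log (1 - x)| := by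
  have h0 : Real.log x ≤ 0 := Real.log_nonpos hx.1.le hx.2.le
  have h1 : Real.log (1 - x) ≤ 0 := Real.log_nonpos (by linarith [hx.2]) (by linarith [hx.1])
  rw [abs_of_nonpos h0, abs_of_nonpos h1, XX, one_mul, abs_of_nonpos (by linarith)]
  ring

lemma log_bound {x : ℝ} (hx : x ∈ Set.Ioo (0:ℝ) 1) :
    |Real.log (1 - x)| / x ≤ 2 * (1 + |Real.log (1 - x)|) := by
  have h0 := hx.1
  have hp : 0 < 1 - x := by linarith [hx.2]
  have h1 : Real.log (1 - x) ≤ 0 := Real.log_nonpos (by linarith [hx.2]) (by linarith [hx.1])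
  rw [div_le_iff₀ h0]
  by_cases h : x ≤ 1 / 2
  · have h2 := Real.one_sub_inv_le_log_of_pos hp
    have h3 : (1 - x)⁻¹ - 1 ≤ 2 * x := by
      rw [sub_le_iff_le_add, inv_le_iff_one_le_mul₀ hp]
      nlinarith
    have : |Real.log (1 - x)| ≤ 2 * x := by
      rw [abs_of_nonpos h1]; linarith
    nlinarith [abs_nonneg (Real.log (1 - x))]
  · push Not at h
    nlinarith [abs_nonneg (Real.log (1 - x))]

lemma ww_bound {n m : ℕ} {i : ℤ} (hi : -(m : ℤ) ≤ i) {x : ℝ} (hx : x ∈ Set.Ioo (0:ℝ) 1) :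
    |ww n m i x| ≤ 2 ^ m * (1 + |XX 1 x|) ^ (n + m) := by
  obtain ⟨k, hk⟩ := Int.eq_ofNat_of_zero_le (show 0 ≤ i + m by omega)
  have hi' : i = (k : ℤ) - (m : ℤ) := by omega
  have h0 := hx.1
  have e : |ww n m i x| = x ^ k * |Real.log x| ^ n * (|Real.log (1 - x)| / x) ^ m := by
    rw [ww, hi', zpow_sub₀ h0.ne', abs_mul, abs_mul, abs_pow, abs_pow, zpow_natCast, zpow_natCast,
      abs_div, abs_pow, abs_pow, abs_of_pos h0, div_pow]
    ring
  rw [e, abs_XX hx]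
  have hL := abs_nonneg (Real.log x)
  have hM := abs_nonneg (Real.log (1 - x))
  calc x ^ k * |Real.log x| ^ n * (|Real.log (1 - x)| / x) ^ m
      ≤ 1 * (1 + (|Real.log x| + |Real.log (1 - x)|)) ^ n *
        (2 * (1 + (|Real.log x| + |Real.log (1 - x)|))) ^ m := by
        gcongr
        · exact pow_le_one₀ h0.le hx.2.le
        · linarith
        · refine (log_bound hx).trans ?_
          linarith
    _ = _ := by rw [mul_pow, pow_add]; ring

lemma meas_XX (s : ℝ) : Measurable (XX s) := by
  unfold XX
  fun_prop

lemma meas_ww (n m : ℕ) (i : ℤ) : Measurable (ww n m i) := by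
  unfold ww
  fun_prop

lemma pow_integrable (N : ℕ) : Integrable (fun x => (1 + |XX 1 x|) ^ N) mu := by
  have h1 := integrable_pow_abs_of_mem_interior_integrableExpSet (zero_mem_int zero_le_one) N
  have h2 : Integrable (fun x => 2 ^ (N - 1) * ((1:ℝ) ^ N + |XX 1 x| ^ N)) mu :=
    ((integrable_const _).add h1).const_mul _
  refine h2.mono' ?_ ?_
  · have := meas_XX 1
    exact Measurable.aestronglyMeasurable (by fun_prop)
  · refine Eventually.of_forall fun x => ?_
    rw [Real.norm_of_nonneg (by positivity)]
    exact add_pow_le zero_le_one (abs_nonneg _) N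

lemma ww_integrable {n m : ℕ} {i : ℤ} (hi : -(m : ℤ) ≤ i) : Integrable (ww n m i) mu := by
  refine ((pow_integrable (n + m)).const_mul (2 ^ m)).mono' (meas_ww n m i).aestronglyMeasurable ?_
  filter_upwards [ae_restrict_mem measurableSet_Ioo] with x hx
  exact ww_bound hi hx

lemma ww_ii {n m : ℕ} {i : ℤ} (hi : -(m : ℤ) ≤ i) : IntervalIntegrable (ww n m i) volume 0 1 := by
  rw [intervalIntegrable_iff_integrableOn_Ioo_of_le zero_le_one]
  exact ww_integrable hi

lemma exp_bound {N : ℕ} {x : ℝ} (hx : x ∈ Set.Ioo (0:ℝ) 1) :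
    x * (1 - x) * (1 + |XX 1 x|) ^ N ≤
      (2 ^ N * N.factorial * Real.exp (1 / 2)) * Real.sqrt (x * (1 - x)) := by
  have h0 := hx.1
  have h1 : 0 < 1 - x := by linarith [hx.2]
  have hX : |XX 1 x| = - Real.log (x * (1 - x)) := by
    rw [abs_XX hx, abs_of_nonpos (Real.log_nonpos hx.1.le hx.2.le),
      abs_of_nonpos (Real.log_nonpos h1.le (by linarith)), Real.log_mul h0.ne' h1.ne']
    ring
  have hp : 0 < x * (1 - x) := mul_pos h0 h1
  have h2 := Real.pow_div_factorial_le_exp ((1 + |XX 1 x|) / 2) (by positivity) N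
  rw [div_le_iff₀ (by positivity), div_pow, div_le_iff₀ (by positivity)] at h2
  have h3 : Real.exp ((1 + |XX 1 x|) / 2) = Real.exp (1 / 2) * (Real.sqrt (x * (1 - x)))⁻¹ := by
    rw [hX, add_div, Real.exp_add, neg_div, Real.exp_neg, Real.exp_half (Real.log (x * (1 - x))),
      Real.exp_log hp]
  have hs : 0 < Real.sqrt (x * (1 - x)) := Real.sqrt_pos.2 hp
  have hss := Real.mul_self_sqrt hp.le
  calc _ ≤ x * (1 - x) * (Real.exp ((1 + |XX 1 x|) / 2) * N.factorial * 2 ^ N) := by gcongr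
    _ = _ := by
      rw [h3]
      generalize Real.sqrt (x * (1 - x)) = r at *
      rw [← hss]
      field_simp

lemma lim_aux {n m : ℕ} {j : ℤ} (hj : 1 - (m : ℤ) ≤ j) {a : ℝ} (ha : a * (1 - a) = 0) {l : Filter ℝ}
    (hl : l ≤ 𝓝 a) (hl2 : ∀ᶠ x in l, x ∈ Set.Ioo (0:ℝ) 1) :
    Tendsto (fun x => (x - 1) * ww n m j x) l (𝓝 0) := by
  have hc : Tendsto (fun x : ℝ => 2 ^ m * ((2 ^ (n + m) * (n + m).factorial * Real.exp (1 / 2)) *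
      Real.sqrt (x * (1 - x)))) l (𝓝 0) := by
    have : Tendsto (fun x : ℝ => 2 ^ m * ((2 ^ (n + m) * (n + m).factorial * Real.exp (1 / 2)) *
      Real.sqrt (x * (1 - x)))) (𝓝 a) (𝓝 (2 ^ m * ((2 ^ (n + m) * (n + m).factorial *
      Real.exp (1 / 2)) * Real.sqrt (a * (1 - a))))) := by
      apply Continuous.tendsto
      fun_prop
    rw [ha] at this
    simp only [Real.sqrt_zero, mul_zero] at this
    exact this.mono_left hl
  refine squeeze_zero_norm' ?_ hc
  filter_upwards [hl2] with x hx
  have h1 : 0 < 1 - x := by linarith [hx.2]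
  have e : (x - 1) * ww n m j x = - (x * (1 - x)) * ww n m (j - 1) x := by
    unfold ww
    rw [show x ^ j = x ^ (j - 1) * x by rw [← zpow_add_one₀ hx.1.ne']; simp]
    ring
  rw [e, norm_mul, norm_neg, Real.norm_of_nonneg (mul_pos hx.1 h1).le, Real.norm_eq_abs]
  calc _ ≤ x * (1 - x) * (2 ^ m * (1 + |XX 1 x|) ^ (n + m)) :=
        mul_le_mul_of_nonneg_left (ww_bound (by omega) hx) (mul_pos hx.1 h1).le
    _ = 2 ^ m * (x * (1 - x) * (1 + |XX 1 x|) ^ (n + m)) := by ring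
    _ ≤ _ := by
      exact mul_le_mul_of_nonneg_left (exp_bound hx) (by positivity)

lemma ww_deriv (n m : ℕ) (j : ℤ) {x : ℝ} (hx : x ∈ Set.Ioo (0:ℝ) 1) :
    HasDerivAt (fun x => (x - 1) * ww n m j x)
      ((j + 1) * ww n m j x - j * ww n m (j - 1) x
        + n * (ww (n - 1) m j x - ww (n - 1) m (j - 1) x) + m * ww n (m - 1) j x) x := by
  have h0 : x ≠ 0 := hx.1.ne'
  have h1 : 1 - x ≠ 0 := by linarith [hx.2]
  have d1 := hasDerivAt_zpow j x (Or.inl h0)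
  have d2 := (Real.hasDerivAt_log h0).pow n
  have d3 := (((hasDerivAt_id x).const_sub 1).log h1).pow m
  have d4 := ((hasDerivAt_id x).sub_const 1).mul ((d1.mul d2).mul d3)
  refine HasDerivAt.congr_deriv d4 ?_
  simp only [ww, Pi.mul_apply, Pi.pow_apply, id]
  rw [show x ^ j = x ^ (j - 1) * x by rw [← zpow_add_one₀ h0]; simp]
  field_simp
  ring

lemma recur (n m : ℕ) (j : ℤ) (hj : 1 - (m : ℤ) ≤ j) :
    (j + 1) * JJ n m j - j * JJ n m (j - 1) + n * (JJ (n - 1) m j - JJ (n - 1) m (j - 1))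
      + m * JJ n (m - 1) j = 0 := by
  have i1 : IntervalIntegrable (ww n m j) volume 0 1 := ww_ii (by omega)
  have i2 : IntervalIntegrable (ww n m (j - 1)) volume 0 1 := ww_ii (by omega)
  have i3 : IntervalIntegrable (ww (n - 1) m j) volume 0 1 := ww_ii (by omega)
  have i4 : IntervalIntegrable (ww (n - 1) m (j - 1)) volume 0 1 := ww_ii (by omega)
  have i5 : IntervalIntegrable (ww n (m - 1) j) volume 0 1 := ww_ii (by omega)
  have a1 := i1.const_mul ((j : ℝ) + 1)
  have a2 := i2.const_mul (j : ℝ)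
  have a3 := (i3.sub i4).const_mul (n : ℝ)
  have a5 := i5.const_mul (m : ℝ)
  have key := intervalIntegral.integral_eq_sub_of_hasDerivAt_of_tendsto zero_lt_one
    (fun x hx => ww_deriv n m j hx) (((a1.sub a2).add a3).add a5)
    (lim_aux hj (by simp) nhdsWithin_le_nhds (Ioo_mem_nhdsGT zero_lt_one))
    (lim_aux hj (by simp) nhdsWithin_le_nhds (Ioo_mem_nhdsLT zero_lt_one))
  rw [intervalIntegral.integral_add ((a1.sub a2).add a3) a5,
    intervalIntegral.integral_add (a1.sub a2) a3, intervalIntegral.integral_sub a1 a2,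
    intervalIntegral.integral_const_mul, intervalIntegral.integral_const_mul,
    intervalIntegral.integral_const_mul, intervalIntegral.integral_const_mul,
    intervalIntegral.integral_sub i3 i4] at key
  simpa [JJ] using key

lemma JJ_zero (n m : ℕ) : JJ n m 0 ∈ ZA := by
  have hJ : ∀ n m, JJ n m 0 = ∫ x, ww n m 0 x ∂mu := fun n m => by
    rw [JJ, intervalIntegral.integral_of_le zero_le_one, integral_Ioc_eq_integral_Ioo]
  have h := vander (N := n + m) (fun k => ((n + m).choose k : ℝ) * JJ k (n + m - k) 0) (fun s => by
    have hm := moment_mem s (n + m)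
    have e : ∀ x, XX s x ^ (n + m) = ∑ k ∈ Finset.range (n + m + 1),
        ((s:ℝ) ^ k * ((n + m).choose k : ℝ)) * ww k (n + m - k) 0 x := by
      intro x
      rw [XX, add_pow]
      refine Finset.sum_congr rfl fun k _ => ?_
      rw [ww, mul_pow, zpow_zero]
      ring
    simp_rw [e] at hm
    rw [integral_finsetSum _ (fun k _ => (ww_integrable (by omega)).const_mul _)] at hm
    simp_rw [integral_const_mul, ← hJ] at hm
    rw [Finset.sum_range] at hm
    convert! hm using 2 with k
    ring) ⟨n, by omega⟩
  simp only [Nat.add_sub_cancel_left] at h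
  have h2 := ZA.mul_mem (ZA_rat (((n + m).choose n : ℚ)⁻¹)) h
  have hc : ((n + m).choose n : ℝ) ≠ 0 := by
    exact_mod_cast (Nat.choose_pos (by omega)).ne'
  push_cast at h2
  rwa [inv_mul_cancel_left₀ hc] at h2

lemma of_mul_mem {q : ℤ} (hq : q ≠ 0) {y : ℝ} (h : (q : ℝ) * y ∈ ZA) : y ∈ ZA := by
  have h2 := ZA.mul_mem (ZA_rat ((q : ℚ)⁻¹)) h
  push_cast at h2
  rwa [inv_mul_cancel_left₀ (by exact_mod_cast hq)] at h2

lemma JJ_nonneg (i : ℕ) : ∀ N n m : ℕ, n + m = N → JJ n m i ∈ ZA := by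
  induction i with
  | zero => intro N n m _; exact JJ_zero n m
  | succ i ih =>
    intro N
    induction N using Nat.strong_induction_on with
    | _ N ihN =>
      intro n m hnm
      have r := recur n m (i + 1) (by omega)
      have e : ((i : ℤ) + 1 - 1) = i := by ring
      rw [e] at r
      have m1 := ih _ n m rfl
      have m2 : (n : ℝ) * (JJ (n - 1) m (i + 1) - JJ (n - 1) m i) ∈ ZA := by
        rcases Nat.eq_zero_or_pos n with h | h
        · simp [h]
        · refine ZA.mul_mem (ZA_nat _) (ZA.sub_mem ?_ (ih _ _ _ rfl))
          exact_mod_cast ihN (n - 1 + m) (by omega) _ _ rfl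
      have m3 : (m : ℝ) * JJ n (m - 1) (i + 1) ∈ ZA := by
        rcases Nat.eq_zero_or_pos m with h | h
        · simp [h]
        · refine ZA.mul_mem (ZA_nat _) ?_
          exact_mod_cast ihN (n + (m - 1)) (by omega) _ _ rfl
      have hq : ((i : ℤ) + 2) ≠ 0 := by omega
      refine of_mul_mem hq ?_
      have := ZA.sub_mem (ZA.sub_mem (ZA.mul_mem (ZA_int (i + 1)) m1) m2) m3
      convert! this using 1
      push_cast at r ⊢
      linarith

lemma JJ_neg (k : ℕ) : ∀ n m : ℕ, k + 1 ≤ m → JJ n m (-(k + 1 : ℤ)) ∈ ZA := by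
  induction k with
  | zero =>
    intro n m hm
    have r := recur (n + 1) m 0 (by omega)
    have hq : ((n : ℤ) + 1) ≠ 0 := by omega
    refine of_mul_mem hq ?_
    have := ZA.add_mem (ZA.add_mem (JJ_zero (n + 1) m) (ZA.mul_mem (ZA_int (n + 1)) (JJ_zero n m)))
      (ZA.mul_mem (ZA_nat m) (JJ_zero (n + 1) (m - 1)))
    convert! this using 1
    simp at r ⊢
    linarith
  | succ k ih =>
    intro n
    induction n with
    | zero =>
      intro m hm
      have r := recur 0 m (-(k + 1 : ℤ)) (by omega)
      have e : (-((k : ℤ) + 1) - 1) = -(((k + 1 : ℕ) : ℤ) + 1) := by push_cast; ring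
      rw [e] at r
      have hq : ((k : ℤ) + 1) ≠ 0 := by omega
      refine of_mul_mem hq ?_
      have := ZA.sub_mem (ZA.mul_mem (ZA_int k) (ih 0 m (by omega)))
        (ZA.mul_mem (ZA_nat m) (ih 0 (m - 1) (by omega)))
      convert! this using 1
      push_cast at r ⊢
      linarith
    | succ n ihn =>
      intro m hm
      have r := recur (n + 1) m (-(k + 1 : ℤ)) (by omega)
      have e : (-((k : ℤ) + 1) - 1) = -(((k + 1 : ℕ) : ℤ) + 1) := by push_cast; ring
      rw [e, Nat.add_sub_cancel] at r
      have hq : ((k : ℤ) + 1) ≠ 0 := by omega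
      refine of_mul_mem hq ?_
      have := ZA.sub_mem (ZA.sub_mem (ZA.mul_mem (ZA_int k) (ih (n + 1) m (by omega)))
        (ZA.mul_mem (ZA_int (n + 1)) (ZA.sub_mem (ih n m (by omega)) (ihn m hm))))
        (ZA.mul_mem (ZA_nat m) (ih (n + 1) (m - 1) (by omega)))
      convert! this using 1
      push_cast at r ⊢
      linarith

/-- The normalized logarithmic integral `S_{n,m}^{(i)}`, for integer `i ≥ -m`, lies in the
ℚ-subalgebra of ℝ generated by the Riemann zeta values `ζ(k)`, `k ≥ 2`. -/
theorem stmt2 (n m : ℕ) (i : ℤ) (hi : -(m : ℤ) ≤ i) :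
    ((-1 : ℝ) ^ (n + m) / ((n.factorial : ℝ) * m.factorial)) *
      ∫ x in (0:ℝ)..1, x ^ i * Real.log x ^ n * Real.log (1 - x) ^ m
    ∈ Algebra.adjoin ℚ
        {x : ℝ | ∃ k : ℕ, 2 ≤ k ∧ x = ∑' ℓ : ℕ, 1 / ((ℓ : ℝ) + 1) ^ k} := by
  have h1 : JJ n m i ∈ ZA := by
    rcases le_or_gt 0 i with h | h
    · obtain ⟨k, rfl⟩ := Int.eq_ofNat_of_zero_le h
      exact JJ_nonneg k _ n m rfl
    · obtain ⟨k, hk⟩ := Int.eq_ofNat_of_zero_le (show 0 ≤ -i - 1 by omega)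
      have : i = -(k + 1 : ℤ) := by omega
      subst this
      exact JJ_neg k n m (by omega)
  have h2 := ZA_rat ((-1 : ℚ) ^ (n + m) / ((n.factorial : ℚ) * m.factorial))
  push_cast at h2
  exact ZA.mul_mem h2 h1
end
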